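/- Let $A$ and $B$ be (possibly infinite) point sets in $\mathbb{R}^d$, each affinely spanning $\mathbb{R}^d$, and let $\gamma \colon A \to B$ be an order-type reversing bijection. Then there exists an affine hyperplane $H \subset \mathbb{R}^d$ which intersects every closed segment $[a, \gamma(a)]$ with $a \in A$. -/

import Mathlib

open Set

/-- Determinant of the (d+1)×(d+1) matrix whose i-th column is the point `a i ∈ ℝ^d`
augmented by a final coordinate equal to 1. -/
noncomputable def liftDet {d : ℕ} (a : Fin (d + 1) → (Fin d → ℝ)) : ℝ :=
  (Matrix.of fun j i : Fin (d + 1) =>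
    Fin.lastCases (1 : ℝ) (fun j' => a i j') j).det

/-- An affine hyperplane in ℝ^d, given as the zero set of a non-trivial affine functional. -/
def IsAffHyperplane {d : ℕ} (H : Set (Fin d → ℝ)) : Prop :=
  ∃ (u : Fin d → ℝ) (c : ℝ), u ≠ 0 ∧ H = {x | ∑ j, u j * x j = c}

/-- A convex curve in ℝ^d: continuous on [0,1] and meets every affine hyperplane
in at most d parameter values. -/
def IsConvexCurve {d : ℕ} (C : ℝ → (Fin d → ℝ)) : Prop :=
  ContinuousOn C (Icc 0 1) ∧
  ∀ H : Set (Fin d → ℝ), IsAffHyperplane H →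
    {t ∈ Icc (0 : ℝ) 1 | C t ∈ H}.encard ≤ (d : ℕ∞)

def PosOriented {d : ℕ} (C : ℝ → (Fin d → ℝ)) : Prop :=
  ∀ t : Fin (d + 1) → ℝ, StrictMono t → (∀ i, t i ∈ Icc (0 : ℝ) 1) →
    0 < liftDet (fun i => C (t i))

def NegOriented {d : ℕ} (C : ℝ → (Fin d → ℝ)) : Prop :=
  ∀ t : Fin (d + 1) → ℝ, StrictMono t → (∀ i, t i ∈ Icc (0 : ℝ) 1) →
    liftDet (fun i => C (t i)) < 0

def OrderTypeReversingOn {d : ℕ} (γ : (Fin d → ℝ) → (Fin d → ℝ))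
    (A : Set (Fin d → ℝ)) : Prop :=
  ∀ a : Fin (d + 1) → (Fin d → ℝ), (∀ i, a i ∈ A) → Function.Injective a →
    Real.sign (liftDet a) = - Real.sign (liftDet (γ ∘ a))

/-- The determinant of `n` vectors in `ℝⁿ` as a continuous alternating map. -/
noncomputable def detForm (n : ℕ) : (Fin n → ℝ) [⋀^Fin n]→L[ℝ] ℝ :=
  { (Matrix.detRowAlternating : (Fin n → ℝ) [⋀^Fin n]→ₗ[ℝ] ℝ) with
    cont := by
      change Continuous fun M : Fin n → Fin n → ℝ => Matrix.det (Matrix.of M)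
      exact Continuous.matrix_det continuous_id }

theorem detForm_apply {n : ℕ} (v : Fin n → Fin n → ℝ) :
    detForm n v = (Matrix.of v).det := rfl

/-- The top-degree form `ρ dy₁ ∧ ⋯ ∧ dyₙ` pulled back by a map `ℝⁿ⁺¹ → ℝⁿ` is closed. -/
theorem sum_fderiv_pullback_detForm_eq_zero {n : ℕ} {F : (Fin (n + 1) → ℝ) → (Fin n → ℝ)}
    (hF : ContDiff ℝ 2 F) {ρ : (Fin n → ℝ) → ℝ} (hρ : Differentiable ℝ ρ)
    (x : Fin (n + 1) → ℝ) :
    ∑ i : Fin (n + 1), (-1 : ℤ) ^ i.val • fderiv ℝ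
      (fun y => ρ (F y) * detForm n fun j => fderiv ℝ F y (Pi.single (i.succAbove j) 1))
      x (Pi.single i 1) = 0 := by
  have hω : Differentiable ℝ fun y => ρ y • detForm n := hρ.smul_const _
  have hpull := extDeriv_pullback (x := x) (hω (F x)) hF.contDiffAt (by simp)
  have hdiff : DifferentiableAt ℝ
      (fun y => (ρ (F y) • detForm n).compContinuousLinearMap (fderiv ℝ F y)) x := by
    have h1 : DifferentiableAt ℝ (fun y => ρ (F y) • detForm n) x :=
      (hω (F x)).comp x (hF.differentiable (by norm_num) x)
    have h2 : DifferentiableAt ℝ (fderiv ℝ F) x :=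
      (hF.fderiv_right (m := 1) (by norm_num)).differentiable (by norm_num) x
    exact h1.continuousAlternatingMapCompContinuousLinearMap h2
  have happ := extDeriv_apply hdiff fun i => Pi.single i 1
  rw [hpull] at happ
  have hdep : (extDeriv (fun y => ρ y • detForm n) (F x)).compContinuousLinearMap (fderiv ℝ F x)
      (fun i => Pi.single i 1) = 0 := by
    rw [ContinuousAlternatingMap.compContinuousLinearMap_apply]
    refine AlternatingMap.map_linearDependent (ContinuousAlternatingMap.toAlternatingMap _) _ ?_
    intro hli
    have := hli.fintype_card_le_finrank
    simp at this
  rw [hdep] at happ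
  rw [happ]
  rfl

/-- Homotopy invariance of the degree, in integral form, for a homotopy between linear maps
whose values on the unit sphere avoid the support of `ρ`. -/
theorem integral_comp_mul_det_eq_of_homotopy {n : ℕ} {F : (Fin (n + 1) → ℝ) → (Fin n → ℝ)}
    (hF : ContDiff ℝ 2 F) {ρ : (Fin n → ℝ) → ℝ} (hρ : ContDiff ℝ 1 ρ)
    (hρF : ∀ t ∈ Icc (0 : ℝ) 1, ∀ x, ‖x‖ = 1 → ρ (F (Fin.cons t x)) = 0)
    {M N : Matrix (Fin n) (Fin n) ℝ}
    (hM : ∀ x, F (Fin.cons 0 x) = M.mulVec x) (hN : ∀ x, F (Fin.cons 1 x) = N.mulVec x) :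
    (∫ x in Icc (fun _ : Fin n => (-1 : ℝ)) (fun _ => 1), ρ (M.mulVec x)) * M.det =
      (∫ x in Icc (fun _ : Fin n => (-1 : ℝ)) (fun _ => 1), ρ (N.mulVec x)) * N.det := by
  set V : (Fin (n + 1) → ℝ) → Fin (n + 1) → ℝ := fun y i =>
    (-1 : ℤ) ^ i.val • (ρ (F y) * detForm n fun j => fderiv ℝ F y (Pi.single (i.succAbove j) 1))
    with hV
  have hf1 : ContDiff ℝ 1 (fderiv ℝ F) := hF.fderiv_right (by norm_num)
  have hg : ∀ i : Fin (n + 1), ContDiff ℝ 1 fun y =>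
      (ρ (F y) * detForm n fun j => fderiv ℝ F y (Pi.single (i.succAbove j) 1)) := by
    intro i
    refine (hρ.comp (hF.of_le (by norm_num))).mul ?_
    refine (detForm n).toContinuousMultilinearMap.contDiff.comp (contDiff_pi.2 fun j => ?_)
    exact hf1.clm_apply contDiff_const
  have hVC : ContDiff ℝ 1 V := contDiff_pi.2 fun i => (hg i).const_smul _
  set a : Fin (n + 1) → ℝ := Fin.cons 0 fun _ => -1 with ha
  set b : Fin (n + 1) → ℝ := Fin.cons 1 fun _ => 1 with hb
  have hab : a ≤ b := by
    intro i
    refine Fin.cases ?_ (fun j => ?_) i <;> simp [a, b]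
  have hdiv0 : ∀ x, ∑ i, fderiv ℝ V x (Pi.single i 1) i = 0 := by
    intro x
    rw [← sum_fderiv_pullback_detForm_eq_zero hF (hρ.differentiable (by norm_num)) x]
    refine Finset.sum_congr rfl fun i _ => ?_
    have h1 := hasFDerivAt_pi'.1 (hVC.differentiable (by norm_num) x).hasFDerivAt i
    have h2 : HasFDerivAt (fun y => V y i) _ x :=
      (((hg i).differentiable (by norm_num) x).hasFDerivAt).fun_const_smul ((-1 : ℤ) ^ i.val)
    have := congrArg (fun L => L (Pi.single i 1)) (h1.unique h2)
    simpa using this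
  have hdiv := MeasureTheory.integral_divergence_of_hasFDerivAt_off_countable a b hab V
    (fun x => fderiv ℝ V x) ∅ countable_empty hVC.continuous.continuousOn
    (fun x _ => (hVC.differentiable (by norm_num) x).hasFDerivAt)
    (by simp only [hdiv0]; exact MeasureTheory.integrableOn_zero)
  simp only [hdiv0, MeasureTheory.integral_zero, Fin.sum_univ_succ] at hdiv
  have hlinear : ∀ (c : ℝ) (P : Matrix (Fin n) (Fin n) ℝ),
      (∀ x, F (Fin.cons c x) = P.mulVec x) → ∀ x,
      V ((0 : Fin (n + 1)).insertNth c x) 0 = ρ (P.mulVec x) * P.det := by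
    intro c P hP x
    have hd : ∀ v, fderiv ℝ F (Fin.cons c x) (Fin.cons 0 v) = P.mulVec v := by
      intro v
      have hline : HasDerivAt (fun s : ℝ => (Fin.cons c (x + s • v) : Fin (n + 1) → ℝ))
          (Fin.cons 0 v) 0 := by
        rw [hasDerivAt_pi]
        intro i
        refine Fin.cases ?_ (fun j => ?_) i
        · simpa using hasDerivAt_const (0 : ℝ) c
        · simpa using ((hasDerivAt_id (0 : ℝ)).mul_const (v j)).const_add (x j)
      have hFd := (hF.differentiable (by norm_num) (Fin.cons c (x + (0 : ℝ) • v))).hasFDerivAt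
      have h1 := hFd.comp_hasDerivAt (0 : ℝ) hline
      have h2 : HasDerivAt (fun s : ℝ => P.mulVec x + s • P.mulVec v) (P.mulVec v) 0 := by
        simpa using ((hasDerivAt_id (0 : ℝ)).smul_const (P.mulVec v)).const_add (P.mulVec x)
      have h3 : (F ∘ fun s : ℝ => (Fin.cons c (x + s • v) : Fin (n + 1) → ℝ)) =
          fun s : ℝ => P.mulVec x + s • P.mulVec v := by
        funext s
        simp [hP, Matrix.mulVec_add, Matrix.mulVec_smul]
      rw [h3] at h1
      simpa using h1.unique h2
    have hsingle : ∀ j : Fin n, (Pi.single j.succ 1 : Fin (n + 1) → ℝ) =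
        Fin.cons 0 (Pi.single j 1) := by
      intro j
      funext i
      refine Fin.cases ?_ (fun k => ?_) i
      · simp [(Fin.succ_ne_zero j).symm]
      · simp [Pi.single_apply]
    simp only [hV, Fin.insertNth_zero', Fin.succAbove_zero, hP, hsingle, hd, detForm_apply,
      Matrix.mulVec_single_one]
    simp only [Fin.val_zero, pow_zero, one_smul]
    exact congrArg _ (Matrix.det_transpose P)
  have hside : ∀ (j : Fin n) (c : ℝ), |c| = 1 →
      (∫ x in Icc (a ∘ j.succ.succAbove) (b ∘ j.succ.succAbove),
        V (j.succ.insertNth c x) j.succ) = 0 := by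
    intro j c hc
    refine MeasureTheory.setIntegral_eq_zero_of_forall_eq_zero fun x hx => ?_
    set z : Fin (n + 1) → ℝ := j.succ.insertNth c x with hz
    have hzj : z j.succ = c := by simp [z]
    have hzI : ∀ k, z k ∈ Icc (a k) (b k) := by
      intro k
      rcases Fin.eq_self_or_eq_succAbove j.succ k with rfl | ⟨k, rfl⟩
      · rw [hzj]
        simpa [a, b, abs_le] using hc.le
      · simpa [z] using And.intro (hx.1 k) (hx.2 k)
    have hz0 : z 0 ∈ Icc (0 : ℝ) 1 := by simpa [a, b] using hzI 0
    have hnorm : ‖Fin.tail z‖ = 1 := by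
      refine le_antisymm ((pi_norm_le_iff_of_nonneg zero_le_one).2 fun k => ?_) ?_
      · have := hzI k.succ
        simpa [a, b, Fin.tail, abs_le] using this
      · have := norm_le_pi_norm (Fin.tail z) j
        simpa [Fin.tail, hzj, hc] using this
    have := hρF (z 0) hz0 (Fin.tail z) hnorm
    rw [Fin.cons_self_tail] at this
    simp [hV, this]
  have hb1 : ∀ j : Fin n, b j.succ = 1 := fun j => by simp [b]
  have ha1 : ∀ j : Fin n, a j.succ = -1 := fun j => by simp [a]
  simp only [hb1, ha1] at hdiv
  rw [Finset.sum_eq_zero fun j _ => by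
    rw [hside j 1 (by simp), hside j (-1) (by simp), sub_zero]] at hdiv
  have hb0 : b 0 = 1 := rfl
  have ha0 : a 0 = 0 := rfl
  have hac : a ∘ (0 : Fin (n + 1)).succAbove = fun _ => -1 := by
    funext j; simp [a]
  have hbc : b ∘ (0 : Fin (n + 1)).succAbove = fun _ => 1 := by
    funext j; simp [b]
  simp only [hb0, ha0, hac, hbc, hlinear 1 N hN, hlinear 0 M hM,
    MeasureTheory.integral_mul_const] at hdiv
  linarith

/-- A linear map of negative determinant cannot be deformed into one of positive determinant
through maps without zeros on the unit sphere. -/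
theorem not_det_pos_of_homotopy {n : ℕ} {F : (Fin (n + 1) → ℝ) → (Fin n → ℝ)}
    (hF : ContDiff ℝ 2 F) (hF0 : ∀ t ∈ Icc (0 : ℝ) 1, ∀ x, ‖x‖ = 1 → F (Fin.cons t x) ≠ 0)
    {M N : Matrix (Fin n) (Fin n) ℝ}
    (hM : ∀ x, F (Fin.cons 0 x) = M.mulVec x) (hN : ∀ x, F (Fin.cons 1 x) = N.mulVec x)
    (hMdet : M.det < 0) : ¬ 0 < N.det := by
  intro hNdet
  obtain ⟨δ, hδ, hδF⟩ : ∃ δ > 0, ∀ t ∈ Icc (0 : ℝ) 1, ∀ x, ‖x‖ = 1 →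
      δ ≤ ‖F (Fin.cons t x)‖ := by
    have hK : IsCompact (Icc (0 : ℝ) 1 ×ˢ Metric.sphere (0 : Fin n → ℝ) 1) :=
      isCompact_Icc.prod (isCompact_sphere 0 1)
    have hc : Continuous fun p : ℝ × (Fin n → ℝ) =>
        ‖F (Fin.cons p.1 p.2)‖ := by
      refine (hF.continuous.comp (continuous_pi fun i => ?_)).norm
      refine Fin.cases ?_ (fun j => ?_) i
      · simpa using continuous_fst
      · simp only [Fin.cons_succ]
        exact (continuous_apply j).comp continuous_snd
    obtain ⟨δ, hδ, h⟩ := hK.exists_forall_le' hc.continuousOn (a := 0)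
      (fun p hp => norm_pos_iff.2 (hF0 p.1 hp.1 p.2 (by simpa using hp.2)))
    exact ⟨δ, hδ, fun t ht x hx => h (t, x) ⟨ht, by simpa using hx⟩⟩
  let ρ : ContDiffBump (0 : Fin n → ℝ) := ⟨δ / 2, δ, by positivity, by linarith⟩
  have hpos : ∀ P : Matrix (Fin n) (Fin n) ℝ,
      0 < ∫ x in Icc (fun _ : Fin n => (-1 : ℝ)) (fun _ => 1), ρ (P.mulVec x) := by
    intro P
    have hcont : Continuous fun x => ρ (P.mulVec x) :=
      ρ.continuous.comp (continuous_const.matrix_mulVec continuous_id)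
    rw [MeasureTheory.setIntegral_pos_iff_support_of_nonneg_ae
      (Filter.Eventually.of_forall fun x => ρ.nonneg)
      (hcont.continuousOn.integrableOn_compact isCompact_Icc)]
    have hopen : IsOpen (Function.support (fun x => ρ (P.mulVec x)) ∩
        Set.pi univ fun _ : Fin n => Ioo (-1 : ℝ) 1) :=
      hcont.isOpen_support.inter (isOpen_set_pi finite_univ fun _ _ => isOpen_Ioo)
    refine (hopen.measure_pos _ ⟨0, ?_, by simp⟩).trans_le (MeasureTheory.measure_mono ?_)
    · have : (0 : ℝ) < ρ 0 := ρ.pos_of_mem_ball (Metric.mem_ball_self hδ)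
      simpa using this.ne'
    · refine inter_subset_inter_right _ fun x hx => ⟨fun i => ?_, fun i => ?_⟩
      · exact (hx i (mem_univ i)).1.le
      · exact (hx i (mem_univ i)).2.le
  have h := integral_comp_mul_det_eq_of_homotopy hF (ρ := ρ) ρ.contDiff
    (fun t ht x hx => ρ.zero_of_le_dist (by simpa using hδF t ht x hx)) hM hN
  have := mul_neg_of_pos_of_neg (hpos M) hMdet
  have := mul_pos (hpos N) hNdet
  linarith

/-- Symmetrized form of the Cauchy–Binet formula. -/
theorem factorial_mul_det_sum_vecMulVec {R ι : Type*} [CommRing R] [Fintype ι] {n : ℕ}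
    (w : ι → R) (α β : ι → Fin n → R) :
    (n.factorial : R) * (∑ i, w i • Matrix.vecMulVec (β i) (α i)).det =
      ∑ r : Fin n → ι, (∏ j, w (r j)) *
        ((Matrix.of fun j => α (r j)).det * (Matrix.of fun j => β (r j)).det) := by
  classical
  have hexpand : (∑ i, w i • Matrix.vecMulVec (β i) (α i)).det =
      ∑ r : Fin n → ι, (∏ j, w (r j) * α (r j) j) * (Matrix.of fun j => β (r j)).det := by
    rw [← Matrix.det_transpose]
    have hrows : (∑ i, w i • Matrix.vecMulVec (β i) (α i)).transpose =
        Matrix.of fun j => ∑ i, (w i * α i j) • β i := by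
      ext j k
      simp [Matrix.sum_apply, Matrix.vecMulVec_apply]
      exact Finset.sum_congr rfl fun i _ => by ring
    rw [hrows]
    refine (MultilinearMap.map_sum
      (Matrix.detRowAlternating : (Fin n → R) [⋀^Fin n]→ₗ[R] R).toMultilinearMap
      (fun j i => (w i * α i j) • β i)).trans (Finset.sum_congr rfl fun r _ => ?_)
    exact MultilinearMap.map_smul_univ _ _ _
  have hperm : ∀ σ : Equiv.Perm (Fin n), (∑ i, w i • Matrix.vecMulVec (β i) (α i)).det =
      ∑ r : Fin n → ι, (∏ j, w (r j)) * ((Equiv.Perm.sign σ : R) * ∏ j, α (r (σ j)) j) *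
        (Matrix.of fun j => β (r j)).det := by
    intro σ
    rw [hexpand, ← (Equiv.arrowCongr σ (Equiv.refl ι)).symm.sum_comp]
    refine Finset.sum_congr rfl fun r _ => ?_
    have hdet : (Matrix.of fun j => β (r (σ j))).det =
        Equiv.Perm.sign σ * (Matrix.of fun j => β (r j)).det :=
      Matrix.det_permute σ (Matrix.of fun j => β (r j))
    have hprod : ∏ j, w (r (σ j)) = ∏ j, w (r j) := Equiv.prod_comp σ fun j => w (r j)
    simp only [Equiv.arrowCongr_symm, Equiv.arrowCongr_apply, Function.comp_apply,
      Equiv.symm_symm, Equiv.refl_symm, Equiv.refl_apply, Finset.prod_mul_distrib, hdet, hprod]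
    ring
  have hsum := Finset.sum_congr rfl fun (σ : Equiv.Perm (Fin n)) (_ : σ ∈ Finset.univ) => hperm σ
  rw [Finset.sum_const, Finset.card_univ, Fintype.card_perm, Fintype.card_fin, nsmul_eq_mul,
    Finset.sum_comm] at hsum
  rw [hsum]
  refine Finset.sum_congr rfl fun r _ => ?_
  rw [← Finset.sum_mul, ← Finset.mul_sum, mul_assoc]
  congr 2
  rw [Matrix.det_apply']
  rfl

theorem det_sum_vecMulVec_neg {ι : Type*} [Fintype ι] {n : ℕ} {w : ι → ℝ} (hw : ∀ i, 0 < w i)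
    {α β : ι → Fin n → ℝ}
    (hle : ∀ r : Fin n → ι,
      (Matrix.of fun j => α (r j)).det * (Matrix.of fun j => β (r j)).det ≤ 0)
    (hlt : ∃ r : Fin n → ι,
      (Matrix.of fun j => α (r j)).det * (Matrix.of fun j => β (r j)).det < 0) :
    (∑ i, w i • Matrix.vecMulVec (β i) (α i)).det < 0 := by
  have hfact : (0 : ℝ) < n.factorial := by exact_mod_cast n.factorial_pos
  have hprod : ∀ r : Fin n → ι, 0 < ∏ j, w (r j) := fun r => Finset.prod_pos fun j _ => hw _
  obtain ⟨r, hr⟩ := hlt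
  refine neg_of_mul_neg_right ?_ hfact.le
  rw [factorial_mul_det_sum_vecMulVec]
  exact Finset.sum_neg' (fun r _ => mul_nonpos_of_nonneg_of_nonpos (hprod r).le (hle r))
    ⟨r, Finset.mem_univ r, mul_neg_of_pos_of_neg (hprod r) hr⟩

theorem max_zero_sub_inv_le_mul_exp {K : ℝ} (hK : 0 < K) (s : ℝ) :
    max s 0 - K⁻¹ ≤ s * Real.exp (K * s) := by
  have hKi : 0 < K⁻¹ := inv_pos.2 hK
  rcases le_total 0 s with hs | hs
  · rw [max_eq_left hs]
    have : 1 ≤ Real.exp (K * s) := Real.one_le_exp (by positivity)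
    nlinarith
  · rw [max_eq_right hs, zero_sub, ← mul_le_mul_iff_right₀ hK]
    have h1 := Real.add_one_le_exp (-(K * s))
    have h2 : Real.exp (-(K * s)) * Real.exp (K * s) = 1 := by rw [← Real.exp_add]; simp
    have h3 := Real.exp_pos (K * s)
    rw [mul_neg, mul_inv_cancel₀ hK.ne']
    nlinarith

/-- If every positive combination of the rank-one matrices `β i (α i)ᵀ` has negative determinant,
then some nonzero `f` satisfies `⟨f, α i⟩ ⟨f, β i⟩ ≤ 0` for all `i`. -/
theorem exists_ne_zero_forall_dotProduct_mul_nonpos {ι : Type*} [Fintype ι] {n : ℕ}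
    (α β : ι → Fin n → ℝ)
    (hneg : ∀ w : ι → ℝ, (∀ i, 0 < w i) →
      (∑ i, w i • Matrix.vecMulVec (β i) (α i)).det < 0) :
    ∃ f : Fin n → ℝ, f ≠ 0 ∧ ∀ i, (α i ⬝ᵥ f) * (β i ⬝ᵥ f) ≤ 0 := by
  by_contra! hcon
  set s : ι → (Fin n → ℝ) → ℝ := fun i x => (α i ⬝ᵥ x) * (β i ⬝ᵥ x) with hs
  have hscont : ∀ i, Continuous (s i) := fun i =>
    (continuous_const.dotProduct continuous_id).mul (continuous_const.dotProduct continuous_id)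
  obtain ⟨c, hc, hcs⟩ : ∃ c > 0, ∀ x, ‖x‖ = 1 → c ≤ ∑ i, max (s i x) 0 := by
    obtain ⟨c, hc, h⟩ := (isCompact_sphere (0 : Fin n → ℝ) 1).exists_forall_le'
      (f := fun x => ∑ i, max (s i x) 0) (a := 0)
      (continuous_finsetSum _ fun i _ => (hscont i).max continuous_const).continuousOn
      (fun x hx => by
        obtain ⟨i, hi⟩ := hcon x (by rintro rfl; simp at hx)
        exact Finset.sum_pos' (fun i _ => le_max_right _ _)
          ⟨i, Finset.mem_univ i, lt_max_of_lt_left hi⟩)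
    exact ⟨c, hc, fun x hx => h x (by simpa using hx)⟩
  obtain ⟨K, hK, hKc⟩ : ∃ K > 0, Fintype.card ι * K⁻¹ < c := by
    refine ⟨(Fintype.card ι + 1) / c, by positivity, ?_⟩
    rw [inv_div, mul_div_assoc', div_lt_iff₀ (by positivity)]
    nlinarith
  have hexp : ∀ x, ‖x‖ = 1 → 0 < ∑ i, s i x * Real.exp (K * s i x) := by
    intro x hx
    calc 0 < (∑ i, max (s i x) 0) - Fintype.card ι * K⁻¹ := by linarith [hcs x hx]
      _ = ∑ i, (max (s i x) 0 - K⁻¹) := by simp [Finset.sum_sub_distrib]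
      _ ≤ _ := Finset.sum_le_sum fun i _ => max_zero_sub_inv_le_mul_exp hK _
  have hmulVec : ∀ (w : ι → ℝ) (x : Fin n → ℝ),
      (∑ i, w i • Matrix.vecMulVec (β i) (α i)).mulVec x = ∑ i, (w i * (α i ⬝ᵥ x)) • β i := by
    intro w x
    rw [Matrix.sum_mulVec]
    refine Finset.sum_congr rfl fun i _ => ?_
    ext j
    simp [Matrix.smul_mulVec, Matrix.vecMulVec_mulVec]
    ring
  set G : ℝ → (Fin n → ℝ) → (Fin n → ℝ) := fun t x =>
    Real.smoothTransition (2 * t - 1) • x + (1 - Real.smoothTransition (2 * t - 1)) •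
      ∑ i, (Real.exp (K * Real.smoothTransition (2 * t) * s i x) * (α i ⬝ᵥ x)) • β i with hG
  have hsmooth : ContDiff ℝ 2 fun z : Fin (n + 1) → ℝ => G (z 0) (Fin.tail z) := by
    have h0 : ContDiff ℝ 2 fun z : Fin (n + 1) → ℝ => z 0 := contDiff_apply ℝ ℝ 0
    have ht : ContDiff ℝ 2 fun z : Fin (n + 1) → ℝ => Fin.tail z :=
      contDiff_pi.2 fun j => contDiff_apply ℝ ℝ j.succ
    have hdot : ∀ v : Fin n → ℝ, ContDiff ℝ 2 fun z : Fin (n + 1) → ℝ => v ⬝ᵥ Fin.tail z :=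
      fun v => ContDiff.sum fun j _ => contDiff_const.mul (contDiff_apply ℝ ℝ j.succ)
    have hst : ContDiff ℝ 2 Real.smoothTransition := Real.smoothTransition.contDiff
    have hl : ContDiff ℝ 2 fun z : Fin (n + 1) → ℝ => Real.smoothTransition (2 * z 0 - 1) :=
      hst.comp ((contDiff_const.mul h0).sub contDiff_const)
    have hk : ContDiff ℝ 2 fun z : Fin (n + 1) → ℝ => Real.smoothTransition (2 * z 0) :=
      hst.comp (contDiff_const.mul h0)
    refine (hl.smul ht).add ((contDiff_const.sub hl).smul (ContDiff.sum fun i _ => ?_))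
    exact ((((contDiff_const.mul hk).mul ((hdot _).mul (hdot _))).exp).mul (hdot _)).smul
      contDiff_const
  refine not_det_pos_of_homotopy hsmooth (M := ∑ i, (1 : ℝ) • Matrix.vecMulVec (β i) (α i))
    (N := 1) ?_ (fun x => ?_) (fun x => ?_) (hneg (fun _ => 1) fun _ => one_pos) (by simp)
  · intro t _ x hx hzero
    simp only [Fin.cons_zero, Fin.tail_cons] at hzero
    have hx0 : x ≠ 0 := by rintro rfl; simp at hx
    rcases le_total t (1 / 2) with ht | ht
    · have hl : Real.smoothTransition (2 * t - 1) = 0 :=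
        Real.smoothTransition.zero_of_nonpos (by linarith)
      simp only [hG, hl, zero_smul, zero_add, sub_zero, one_smul] at hzero
      rw [← hmulVec] at hzero
      exact (hneg _ fun i => Real.exp_pos _).ne
        (Matrix.exists_mulVec_eq_zero_iff.1 ⟨x, hx0, hzero⟩)
    · have hk : Real.smoothTransition (2 * t) = 1 :=
        Real.smoothTransition.one_of_one_le (by linarith)
      have hdot := congrArg (fun y => y ⬝ᵥ x) hzero
      simp only [hG, hk, mul_one, add_dotProduct, smul_dotProduct, sum_dotProduct,
        zero_dotProduct, smul_eq_mul] at hdot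
      have hsum : ∑ i, Real.exp (K * s i x) * (α i ⬝ᵥ x) * (β i ⬝ᵥ x) =
          ∑ i, s i x * Real.exp (K * s i x) :=
        Finset.sum_congr rfl fun i _ => by simp only [hs]; ring
      rw [hsum] at hdot
      have hxx : 0 < x ⬝ᵥ x := by
        simpa using Matrix.dotProduct_star_self_pos_iff.2 hx0
      have hE := hexp x hx
      have hl0 := Real.smoothTransition.nonneg (2 * t - 1)
      have hl1 := Real.smoothTransition.le_one (2 * t - 1)
      rcases hl0.eq_or_lt with hl | hl
      · rw [← hl] at hdot
        linarith
      · nlinarith [mul_pos hl hxx, mul_nonneg (sub_nonneg.2 hl1) hE.le]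
  · rw [hmulVec]
    have hl : Real.smoothTransition (-1) = 0 := Real.smoothTransition.zero_of_nonpos (by norm_num)
    simp [hG, hl]
  · have hl : Real.smoothTransition (2 - 1) = 1 :=
      Real.smoothTransition.one_of_one_le (by norm_num)
    simp [hG, hl]

/-- The point `x` with a final coordinate `1` appended. -/
def homogenize {d : ℕ} (x : Fin d → ℝ) : Fin (d + 1) → ℝ :=
  fun j => Fin.lastCases 1 (fun j' => x j') j

theorem homogenize_dotProduct {d : ℕ} (x : Fin d → ℝ) (f : Fin (d + 1) → ℝ) :
    homogenize x ⬝ᵥ f = ∑ j, f (Fin.castSucc j) * x j + f (Fin.last d) := by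
  simp [dotProduct, Fin.sum_univ_castSucc, homogenize, mul_comm]

theorem liftDet_eq_det_homogenize {d : ℕ} (a : Fin (d + 1) → Fin d → ℝ) :
    liftDet a = (Matrix.of fun i => homogenize (a i)).det :=
  Matrix.det_transpose (Matrix.of fun i => homogenize (a i))

theorem exists_injective_liftDet_ne_zero {d : ℕ} {A : Set (Fin d → ℝ)}
    (hA : affineSpan ℝ A = ⊤) :
    ∃ a : Fin (d + 1) → Fin d → ℝ,
      (∀ i, a i ∈ A) ∧ Function.Injective a ∧ liftDet a ≠ 0 := by
  obtain ⟨t, htA, hspan, hind⟩ := exists_affineIndependent ℝ (Fin d → ℝ) A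
  have : Finite t := finite_of_fin_dim_affineIndependent ℝ hind
  have : Fintype t := Fintype.ofFinite t
  have hcard : Fintype.card t = d + 1 := by
    have h := hind.affineSpan_eq_top_iff_card_eq_finrank_add_one.1
      (by rw [Subtype.range_coe, hspan, hA])
    simpa using h
  let e : Fin (d + 1) ≃ t := (Fintype.equivFinOfCardEq hcard).symm
  have hinde : AffineIndependent ℝ fun i => (e i : Fin d → ℝ) :=
    hind.comp_embedding e.toEmbedding
  refine ⟨fun i => e i, fun i => htA (e i).2, Subtype.val_injective.comp e.injective, ?_⟩
  intro hdet
  obtain ⟨v, hv, hmul⟩ := Matrix.exists_mulVec_eq_zero_iff.2 hdet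
  refine hv (funext fun i => ?_)
  refine affineIndependent_iff.1 hinde Finset.univ v ?_ ?_ i (Finset.mem_univ i)
  · simpa [Matrix.mulVec, dotProduct] using congrFun hmul (Fin.last d)
  · funext j
    simpa [Matrix.mulVec, dotProduct, mul_comm] using congrFun hmul (Fin.castSucc j)

theorem liftDet_eq_zero_of_not_injective {d : ℕ} {a : Fin (d + 1) → Fin d → ℝ}
    (ha : ¬ Function.Injective a) : liftDet a = 0 := by
  obtain ⟨i, j, hij, hne⟩ := Function.not_injective_iff.1 ha
  rw [liftDet_eq_det_homogenize]
  exact Matrix.det_zero_of_row_eq hne (congrArg homogenize hij)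

theorem mul_neg_of_sign_eq_neg_sign {x y : ℝ} (h : Real.sign x = -Real.sign y) (hx : x ≠ 0) :
    x * y < 0 := by
  rcases hx.lt_or_gt with hx | hx <;> rcases lt_trichotomy y 0 with hy | hy | hy <;>
    simp_all [Real.sign_of_neg, Real.sign_of_pos, mul_neg_of_neg_of_pos, mul_neg_of_pos_of_neg]
  all_goals norm_num at h

theorem OrderTypeReversingOn.liftDet_mul_nonpos {d : ℕ} {γ : (Fin d → ℝ) → (Fin d → ℝ)}
    {A : Set (Fin d → ℝ)} (h : OrderTypeReversingOn γ A) {a : Fin (d + 1) → Fin d → ℝ}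
    (ha : ∀ i, a i ∈ A) : liftDet a * liftDet (γ ∘ a) ≤ 0 := by
  by_cases h0 : liftDet a = 0
  · simp [h0]
  · have hinj : Function.Injective a := not_imp_comm.1 liftDet_eq_zero_of_not_injective h0
    exact (mul_neg_of_sign_eq_neg_sign (h a ha hinj) h0).le

theorem OrderTypeReversingOn.exists_ne_zero_forall_nonpos {d : ℕ}
    {γ : (Fin d → ℝ) → (Fin d → ℝ)} {A : Set (Fin d → ℝ)} (h : OrderTypeReversingOn γ A)
    (hA : affineSpan ℝ A = ⊤) :
    ∃ f : Fin (d + 1) → ℝ, f ≠ 0 ∧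
      ∀ a ∈ A, (homogenize a ⬝ᵥ f) * (homogenize (γ a) ⬝ᵥ f) ≤ 0 := by
  classical
  by_contra! hcon
  obtain ⟨a, haA, hinj, hdet⟩ := exists_injective_liftDet_ne_zero hA
  obtain ⟨T, hT⟩ := (isCompact_sphere (0 : Fin (d + 1) → ℝ) 1).elim_finite_subcover
    (fun p : A => {f | 0 < (homogenize p.1 ⬝ᵥ f) * (homogenize (γ p.1) ⬝ᵥ f)})
    (fun p => isOpen_lt continuous_const
      ((continuous_const.dotProduct continuous_id).mul
        (continuous_const.dotProduct continuous_id)))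
    (fun f hf => by
      obtain ⟨p, hpA, hp⟩ := hcon f (by rintro rfl; simp at hf)
      exact mem_iUnion.2 ⟨⟨p, hpA⟩, hp⟩)
  set T' : Finset A := T ∪ Finset.univ.image fun i => ⟨a i, haA i⟩ with hT'
  have haT : ∀ i, (⟨a i, haA i⟩ : A) ∈ T' := fun i =>
    Finset.mem_union_right _ (Finset.mem_image_of_mem _ (Finset.mem_univ i))
  obtain ⟨f, hf0, hf⟩ := exists_ne_zero_forall_dotProduct_mul_nonpos
    (fun p : T' => homogenize p.1.1) (fun p : T' => homogenize (γ p.1.1)) fun w hw => by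
      refine det_sum_vecMulVec_neg hw (fun r => ?_) ⟨fun i => ⟨⟨a i, haA i⟩, haT i⟩, ?_⟩
      · have := h.liftDet_mul_nonpos (a := fun j => (r j).1.1) fun i => (r i).1.2
        simpa only [liftDet_eq_det_homogenize, Function.comp_apply] using this
      · have := mul_neg_of_sign_eq_neg_sign (h a haA hinj) hdet
        simpa only [liftDet_eq_det_homogenize, Function.comp_apply] using this
  have hnorm : 0 < ‖f‖ := norm_pos_iff.2 hf0
  obtain ⟨p, hpT, hp⟩ := mem_iUnion₂.1 (hT (show ‖f‖⁻¹ • f ∈ Metric.sphere 0 1 by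
    simp [norm_smul, hnorm.ne']))
  have hle := hf ⟨p, Finset.mem_union_left _ hpT⟩
  simp only [mem_ofPred_eq, dotProduct_smul, smul_eq_mul] at hp
  have : ‖f‖⁻¹ * ‖f‖⁻¹ * ((homogenize p.1 ⬝ᵥ f) * (homogenize (γ p.1) ⬝ᵥ f)) ≤ 0 :=
    mul_nonpos_of_nonneg_of_nonpos (by positivity) hle
  linarith

theorem segment_inter_nonempty_of_mul_nonpos {E : Type*} [AddCommGroup E] [Module ℝ E]
    [TopologicalSpace E] [ContinuousAdd E] [ContinuousSMul ℝ E] {g : E → ℝ} (hg : Continuous g)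
    {c : ℝ} {x y : E} (h : (g x - c) * (g y - c) ≤ 0) :
    (segment ℝ x y ∩ {z | g z = c}).Nonempty := by
  have hconn : IsPreconnected (segment ℝ x y) := (convex_segment x y).isPreconnected
  have hx := left_mem_segment ℝ x y
  have hy := right_mem_segment ℝ x y
  rcases mul_nonpos_iff.1 h with ⟨h1, h2⟩ | ⟨h1, h2⟩
  · exact hconn.intermediate_value hy hx hg.continuousOn ⟨by linarith, by linarith⟩
  · exact hconn.intermediate_value hx hy hg.continuousOn ⟨by linarith, by linarith⟩

/-- **Cutting order-type reversed point sets.** If `A` and `B` are (possibly infinite) point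
sets affinely spanning ℝ^d and `γ` is an order-type reversing bijection from `A` to `B`,
then some affine hyperplane meets every segment `[a, γ a]` with `a ∈ A`. -/
theorem cutting_ordertypes {d : ℕ} (A B : Set (Fin d → ℝ))
    (hA : affineSpan ℝ A = ⊤) (hB : affineSpan ℝ B = ⊤)
    (γ : (Fin d → ℝ) → (Fin d → ℝ)) (hγ : Set.BijOn γ A B)
    (hrev : OrderTypeReversingOn γ A) :
    ∃ H : Set (Fin d → ℝ), IsAffHyperplane H ∧
      ∀ a ∈ A, (segment ℝ a (γ a) ∩ H).Nonempty := by
  obtain ⟨f, hf0, hf⟩ := hrev.exists_ne_zero_forall_nonpos hA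
  simp only [homogenize_dotProduct] at hf
  refine ⟨_, ⟨fun j => f (Fin.castSucc j), -f (Fin.last d), ?_, rfl⟩, fun a ha => ?_⟩
  · intro hu
    obtain ⟨a, ha⟩ : A.Nonempty := by
      rw [← affineSpan_nonempty ℝ, hA]
      exact ⟨0, trivial⟩
    have hzero : ∀ j : Fin d, f (Fin.castSucc j) = 0 := congrFun hu
    have hlast := hf a ha
    simp only [hzero, zero_mul, Finset.sum_const_zero, zero_add] at hlast
    refine hf0 (funext fun j => Fin.lastCases ?_ hzero j)
    exact mul_self_eq_zero.1 (le_antisymm hlast (mul_self_nonneg _))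
  · have hcont : Continuous fun x : Fin d → ℝ => ∑ j, f (Fin.castSucc j) * x j := by fun_prop
    refine segment_inter_nonempty_of_mul_nonpos hcont ?_
    simpa only [sub_neg_eq_add] using hf a ha
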